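/- Let G be a group and T a finite normal subgroup of G. Then for every natural number j there is an isomorphism of abelian groups between the group cohomology H^j(G; ℤ[G]) and H^j(G/T; ℤ[G/T]), where in each case the coefficients are the left regular representation of the respective group. -/

import Mathlib

open CategoryTheory Limits

universe u

namespace Rep

noncomputable section

variable {k G : Type u} [CommRing k] [Group G]

theorem shortExact_iff (X : ShortComplex (Rep.{u} k G)) :
    X.ShortExact ↔ Function.Injective X.f.hom ∧ Function.Exact X.f.hom X.g.hom ∧
      Function.Surjective X.g.hom := by
  have hE : X.Exact ↔ Function.Exact X.f.hom X.g.hom := by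
    rw [← ShortComplex.exact_map_iff_of_faithful X (forget₂ (Rep.{u} k G) (ModuleCat.{u} k)),
      ShortComplex.ShortExact.moduleCat_exact_iff_function_exact]
    rfl
  rw [← mono_iff_injective, ← epi_iff_surjective, ← hE]
  exact ⟨fun h => ⟨h.mono_f, h.exact, h.epi_g⟩,
    fun h => { exact := h.2.1, mono_f := h.1, epi_g := h.2.2 }⟩

variable (T : Subgroup G)

/-- The identity of `A` is the trace over `T` of a `k`-linear endomorphism; equivalently,
`A` is injective relative to the trivial subgroup as a representation of `T`. -/
def IsTraceOne [Fintype T] (A : Rep.{u} k G) : Prop :=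
  ∃ e : A →ₗ[k] A, ∀ a : A, ∑ t : T, A.ρ t (e (A.ρ (t : G)⁻¹ a)) = a

variable {T}

/-- A `k`-split short exact sequence whose left term has trace one splits over `T`. -/
theorem IsTraceOne.exists_section [Fintype T] {X : ShortComplex (Rep.{u} k G)} (hX : X.ShortExact)
    (hA : IsTraceOne T X.X₁) (r : X.X₂ →ₗ[k] X.X₁) (hr : ∀ a, r (X.f.hom a) = a) :
    ∃ s : X.X₃ →ₗ[k] X.X₂, (∀ q, X.g.hom (s q) = q) ∧
      ∀ (t : T) (q : X.X₃), s (X.X₃.ρ t q) = X.X₂.ρ t (s q) := by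
  obtain ⟨e, he⟩ := hA
  obtain ⟨-, hex, hsurj⟩ := (shortExact_iff X).1 hX
  let R : X.X₂ →ₗ[k] X.X₁ := ∑ t : T, X.X₁.ρ t ∘ₗ e ∘ₗ r ∘ₗ X.X₂.ρ (t : G)⁻¹
  have hR (x) : R x = ∑ t : T, X.X₁.ρ t (e (r (X.X₂.ρ (t : G)⁻¹ x))) := by
    simp [R, LinearMap.sum_apply]
  have hRf (a) : R (X.f.hom a) = a := by
    rw [hR]
    conv_rhs => rw [← he a]
    refine Finset.sum_congr rfl fun t _ => ?_
    rw [← hom_comm_apply, hr]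
  have hRT (t : T) (x) : R (X.X₂.ρ t x) = X.X₁.ρ t (R x) := by
    rw [hR, hR, map_sum]
    refine (Fintype.sum_equiv (Equiv.mulLeft t) _ _ fun u => ?_).symm
    simp only [Equiv.coe_mulLeft, Subgroup.coe_mul, mul_inv_rev, map_mul, Module.End.mul_apply,
      Representation.inv_self_apply]
  let p : X.X₂ →ₗ[k] X.X₂ := LinearMap.id - X.f.hom.toLinearMap ∘ₗ R
  have hp (x) : p x = x - X.f.hom (R x) := rfl
  have hpk : LinearMap.ker X.g.hom.toLinearMap ≤ LinearMap.ker p := by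
    intro x hx
    obtain ⟨a, rfl⟩ := (hex x).1 hx
    rw [LinearMap.mem_ker, hp, hRf, sub_self]
  let s : X.X₃ →ₗ[k] X.X₂ := (LinearMap.ker X.g.hom.toLinearMap).liftQ p hpk ∘ₗ
    (X.g.hom.toLinearMap.quotKerEquivOfSurjective hsurj).symm.toLinearMap
  have hs (x) : s (X.g.hom x) = p x := by
    have : (X.g.hom.toLinearMap.quotKerEquivOfSurjective hsurj).symm (X.g.hom x) =
        Submodule.Quotient.mk x := by
      rw [LinearEquiv.symm_apply_eq]; rfl
    simp only [s, LinearMap.comp_apply, LinearEquiv.coe_coe, this,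
      Submodule.liftQ_apply]
  refine ⟨s, fun q => ?_, fun t q => ?_⟩
  · obtain ⟨x, rfl⟩ := hsurj q
    rw [hs, hp, map_sub, (hex _).2 ⟨_, rfl⟩, sub_zero]
  · obtain ⟨x, rfl⟩ := hsurj q
    rw [← hom_comm_apply, hs, hs, hp, hp, hRT, map_sub, hom_comm_apply]

theorem IsTraceOne.of_section [Fintype T] {A B : Rep.{u} k G} (hA : IsTraceOne T A) (g : A ⟶ B)
    (s : B →ₗ[k] A) (hgs : ∀ q, g.hom (s q) = q)
    (hs : ∀ (t : T) (q : B), s (B.ρ t q) = A.ρ t (s q)) : IsTraceOne T B := by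
  obtain ⟨e, he⟩ := hA
  refine ⟨g.hom.toLinearMap ∘ₗ e ∘ₗ s, fun q => ?_⟩
  conv_rhs => rw [← hgs q, ← he (s q), map_sum]
  refine Finset.sum_congr rfl fun t _ => ?_
  have := hs t⁻¹ q
  simp only [Subgroup.coe_inv] at this
  rw [hom_comm_apply, ← this]
  rfl

instance [T.Normal] : (quotientToInvariantsFunctor.{u} k T).PreservesZeroMorphisms where
  map_zero _ _ := rfl

theorem quotientToInvariantsFunctor_shortExact [T.Normal] {X : ShortComplex (Rep.{u} k G)}
    (hX : X.ShortExact) (s : X.X₃ →ₗ[k] X.X₂) (hgs : ∀ q, X.g.hom (s q) = q)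
    (hs : ∀ (t : T) (q : X.X₃), s (X.X₃.ρ t q) = X.X₂.ρ t (s q)) :
    (X.map (quotientToInvariantsFunctor k T)).ShortExact := by
  obtain ⟨hinj, hex, -⟩ := (shortExact_iff X).1 hX
  refine (shortExact_iff _).2 ⟨fun x y h => ?_, fun x => ⟨fun h => ?_, ?_⟩, fun q => ?_⟩
  · exact Subtype.ext (hinj (congrArg Subtype.val h))
  · obtain ⟨a, ha⟩ := (hex x.1).1 (congrArg Subtype.val h)
    refine ⟨⟨a, fun t => hinj ?_⟩, Subtype.ext ha⟩
    have := x.2 t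
    exact (hom_comm_apply X.f (t : G) a).trans (by rw [ha]; exact this)
  · rintro ⟨a, rfl⟩
    exact Subtype.ext ((hex _).2 ⟨a.1, rfl⟩)
  · exact ⟨⟨s q.1, fun t => (hs t q.1).symm.trans (congrArg s (q.2 t))⟩, Subtype.ext (hgs q.1)⟩

theorem IsTraceOne.isZero_H1 [Fintype T] {A : Rep.{u} k G} (hA : IsTraceOne T A) :
    IsZero (groupCohomology (res T.subtype A) 1) := by
  obtain ⟨e, he⟩ := hA
  rw [ModuleCat.isZero_iff_subsingleton]
  refine subsingleton_of_forall_eq 0 fun x => ?_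
  induction x using groupCohomology.H1_induction_on with | @h c =>
  rw [groupCohomology.H1π_eq_zero_iff]
  have hc : ∀ g h : T, c (g * h) = A.ρ g (c h) + c g := (groupCohomology.mem_cocycles₁_iff c).1 c.2
  let m : A := ∑ t : T, A.ρ t (e (c t⁻¹))
  refine ⟨m, funext fun s => ?_⟩
  change A.ρ s m - m = c s
  rw [sub_eq_iff_eq_add]
  have h1 : A.ρ s m = ∑ t : T, A.ρ t (e (c (t⁻¹ * s))) := by
    rw [map_sum]
    refine Fintype.sum_equiv (Equiv.mulLeft s) _ _ fun u => ?_
    simp [map_mul]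
  rw [h1]
  conv_rhs => rw [← he (c s)]
  rw [← Finset.sum_add_distrib]
  refine Finset.sum_congr rfl fun t _ => ?_
  rw [hc, map_add, map_add]
  rfl

variable (k G) in
/-- The representation of `G` on functions `G → V` by right translation. -/
abbrev funRep (V : Type u) [AddCommGroup V] [Module k V] : Rep.{u} k G :=
  Rep.of (X := G → V)
    { toFun g := LinearMap.funLeft k V (· * g)
      map_one' := by ext; simp [LinearMap.funLeft]
      map_mul' _ _ := by ext; simp [LinearMap.funLeft, mul_assoc] }

section funRep

variable (V : Type u) [AddCommGroup V] [Module k V]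

theorem funRep_ρ_apply (g x : G) (f : G → V) : ((funRep k G V).ρ g f : G → V) x = f (x * g) := rfl

variable (k G) in
/-- `funRep k G V` is coinduced from the trivial subgroup. -/
def funRepIsoCoind : funRep k G V ≅
    coind (⊥ : Subgroup G).subtype (Rep.trivial k (⊥ : Subgroup G) V) :=
  Rep.mkIso <| .mk
    { toFun f := ⟨f, fun g x => by simp [Subgroup.mem_bot.1 g.2]⟩
      map_add' _ _ := rfl
      map_smul' _ _ := rfl
      invFun f := f.1
      left_inv _ := rfl
      right_inv _ := rfl } fun _ => rfl

theorem isZero_groupCohomology_funRep (n : ℕ) :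
    IsZero (groupCohomology (funRep k G V) (n + 1)) :=
  (isZero_groupCohomology_succ_of_subsingleton _ n).of_iso <|
    (groupCohomology.functor k G (n + 1)).mapIso (funRepIsoCoind k G V) ≪≫
      groupCohomology.coindIso _ (n + 1)

variable (T) in
/-- The `T`-invariant functions on `G` are the functions on `G ⧸ T`. -/
def quotientToInvariantsFunRepIso [T.Normal] :
    (funRep k G V).quotientToInvariants T ≅ funRep k (G ⧸ T) V :=
  Rep.mkIso <| .mk
    { toFun f := fun q => Quotient.liftOn' q (f.1 : G → V) fun x y h => by
        have := congrFun (f.2 ⟨x⁻¹ * y, QuotientGroup.leftRel_apply.1 h⟩) x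
        simpa using this.symm.trans (congrArg (f.1 : G → V) (mul_inv_cancel_left x y))
      map_add' _ _ := funext fun q => QuotientGroup.induction_on q fun _ => rfl
      map_smul' _ _ := funext fun q => QuotientGroup.induction_on q fun _ => rfl
      invFun f := ⟨fun x => f x, fun t => funext fun x =>
        congrArg f (QuotientGroup.mk_mul_of_mem x t.2)⟩
      left_inv _ := rfl
      right_inv f := funext fun q => QuotientGroup.induction_on q fun _ => rfl } fun g =>
    QuotientGroup.induction_on g fun g => LinearMap.ext fun f => funext fun q =>
      QuotientGroup.induction_on q fun _ => rfl

theorem isTraceOne_funRep [Fintype T] : IsTraceOne T (funRep k G V) := by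
  classical
  let e : (G → V) →ₗ[k] (G → V) :=
    LinearMap.pi fun x => if (x : G ⧸ T).out = x then LinearMap.proj x else 0
  have he (f : G → V) (x : G) : e f x = if (x : G ⧸ T).out = x then f x else 0 := by
    simp only [e, LinearMap.pi_apply]; split_ifs <;> rfl
  refine ⟨e, fun f => funext fun x => ?_⟩
  have hx : x⁻¹ * (x : G ⧸ T).out ∈ T := QuotientGroup.eq.1 (QuotientGroup.out_eq' _).symm
  have key (t : T) : ((funRep k G V).ρ t (e ((funRep k G V).ρ (t : G)⁻¹ f)) : G → V) x =
      if t = ⟨_, hx⟩ then (f : G → V) x else 0 := by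
    refine (he _ (x * t)).trans ?_
    rw [QuotientGroup.mk_mul_of_mem x t.2, funRep_ρ_apply, mul_inv_cancel_right]
    refine if_congr ?_ rfl rfl
    rw [Subtype.ext_iff, eq_inv_mul_iff_mul_eq, eq_comm]
  refine (Finset.sum_apply x _ _).trans ((Finset.sum_congr rfl fun t _ => key t).trans ?_)
  simp only [Finset.sum_ite_eq', Finset.mem_univ, if_true]

/-- The orbit embedding of a representation into functions on the group. -/
def toFunRep (A : Rep.{u} k G) : A ⟶ funRep k G A :=
  Rep.ofHom
    { toLinearMap := LinearMap.pi fun x => A.ρ x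
      isIntertwining' g := LinearMap.ext fun a => funext fun x =>
        (LinearMap.congr_fun (A.ρ.map_mul x g) a).symm }

instance (A : Rep.{u} k G) : Mono (toFunRep A) := by
  refine (mono_iff_injective _).2 fun a b h => ?_
  have h : A.ρ 1 a = A.ρ 1 b := congrFun h (1 : G)
  simpa using h

end funRep

/-- `H^j(G, A) ≅ H^j(G ⧸ T, A^T)` when `A` has trace one over the finite normal subgroup `T`. -/
theorem IsTraceOne.nonempty_iso [T.Normal] [Fintype T] (j : ℕ) {A : Rep.{u} k G}
    (hA : IsTraceOne T A) :
    Nonempty (groupCohomology (A.quotientToInvariants T) j ≅ groupCohomology A j) := by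
  rcases j with _ | j
  · refine ⟨groupCohomology.H0Iso _ ≪≫ LinearEquiv.toModuleIso ?_ ≪≫
      (groupCohomology.H0Iso A).symm⟩
    exact
      { toFun x := ⟨x.1.1, fun g => congrArg Subtype.val (x.2 (g : G ⧸ T))⟩
        map_add' _ _ := rfl
        map_smul' _ _ := rfl
        invFun x := ⟨⟨x.1, fun t => x.2 t⟩, fun g =>
          QuotientGroup.induction_on g fun g => Subtype.ext (x.2 g)⟩
        left_inv _ := rfl
        right_inv _ := rfl }
  induction j generalizing A with
  | zero =>
    have := (groupCohomology.H1InfRes_exact A T).epi_f (hA.isZero_H1.eq_of_tgt _ _)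
    have : IsIso (groupCohomology.H1InfRes A T).f := isIso_of_mono_of_epi _
    let i := asIso (groupCohomology.H1InfRes A T).f
    exact ⟨i⟩
  | succ j ih =>
    let X : ShortComplex (Rep.{u} k G) :=
      ShortComplex.mk (toFunRep A) (cokernel.π (toFunRep A)) (cokernel.condition _)
    have hX : X.ShortExact :=
      { exact := ShortComplex.exact_cokernel _
        mono_f := inferInstanceAs (Mono (toFunRep A))
        epi_g := inferInstanceAs (Epi (cokernel.π (toFunRep A))) }
    obtain ⟨s, hgs, hs⟩ := IsTraceOne.exists_section (X := X) hX hA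
      (LinearMap.proj (R := k) (φ := fun _ : G => A) (1 : G))
      (fun a => by exact LinearMap.congr_fun A.ρ.map_one a)
    have hQ : IsTraceOne T X.X₃ := (isTraceOne_funRep (A : Type u)).of_section X.g s hgs hs
    have hXT := quotientToInvariantsFunctor_shortExact hX s hgs hs
    have hz (n : ℕ) :
        IsZero (groupCohomology (X.map (quotientToInvariantsFunctor k T)).X₂ (n + 1)) :=
      (isZero_groupCohomology_funRep (k := k) (G := G ⧸ T) (A : Type u) n).of_iso <|
        (groupCohomology.functor k (G ⧸ T) (n + 1)).mapIso (quotientToInvariantsFunRepIso T A)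
    have := groupCohomology.isIso_δ_of_isZero hX (j + 1) (isZero_groupCohomology_funRep _ j)
      (isZero_groupCohomology_funRep _ (j + 1))
    have := groupCohomology.isIso_δ_of_isZero hXT (j + 1) (hz j) (hz (j + 1))
    obtain ⟨i⟩ := ih hQ
    exact ⟨(asIso (groupCohomology.δ hXT (j + 1) (j + 2) rfl)).symm ≪≫ i ≪≫
      asIso (groupCohomology.δ hX (j + 1) (j + 2) rfl)⟩

section leftRegular

theorem isTraceOne_leftRegular [T.Normal] [Fintype T] : IsTraceOne T (leftRegular k G) := by
  classical
  let p (x : G) : Prop := (x : G ⧸ T).out = x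
  let e : MonoidAlgebra k G →ₗ[k] MonoidAlgebra k G :=
    (MonoidAlgebra.coeffLinearEquiv k).symm.toLinearMap ∘ₗ
      (Finsupp.lsum k fun x => if p x then Finsupp.lsingle x else 0) ∘ₗ
      (MonoidAlgebra.coeffLinearEquiv k).toLinearMap
  have he (x : G) (r : k) : e (.single x r) = if p x then .single x r else 0 := by
    simp only [e, LinearMap.comp_apply]
    split_ifs with h <;> simp [h]
  have key (x : G) (r : k) : ∑ t : T, Representation.leftRegular k G t
      (e (Representation.leftRegular k G (t : G)⁻¹ (.single x r))) = .single x r := by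
    have hx : x * (x : G ⧸ T).out⁻¹ ∈ T :=
      (‹T.Normal›.mem_comm_iff).1 (QuotientGroup.eq.1 (QuotientGroup.out_eq' (x : G ⧸ T)))
    have (t : T) : Representation.leftRegular k G t
        (e (Representation.leftRegular k G (t : G)⁻¹ (.single x r))) =
          if t = ⟨_, hx⟩ then MonoidAlgebra.single x r else 0 := by
      have hq : (((t : G)⁻¹ * x : G) : G ⧸ T) = x := by
        rw [eq_comm, QuotientGroup.eq, ← mul_assoc]
        simpa using ‹T.Normal›.conj_mem _ (inv_mem t.2) x⁻¹
      have hp : p ((t : G)⁻¹ * x) ↔ t = ⟨_, hx⟩ := by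
        rw [Subtype.ext_iff, eq_mul_inv_iff_mul_eq, eq_comm (b := x), ← inv_mul_eq_iff_eq_mul,
          eq_comm, ← hq]
      rw [Representation.ofMulAction_single, smul_eq_mul, he, if_congr hp rfl rfl]
      split_ifs <;> simp
    simp only [this, Finset.sum_ite_eq', Finset.mem_univ, if_true]
  refine ⟨e, fun a => ?_⟩
  have h : ∑ t : T, Representation.leftRegular k G t ∘ₗ e ∘ₗ
      Representation.leftRegular k G (t : G)⁻¹ = LinearMap.id := by
    ext x : 2
    simpa [LinearMap.sum_apply] using key x 1
  simpa [LinearMap.sum_apply] using LinearMap.congr_fun h a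

theorem coeff_mul_of_mem_invariants [T.Normal]
    (a : (leftRegular k G).quotientToInvariants T) (x : G) {t : G}
    (ht : t ∈ T) : a.1.coeff (x * t) = a.1.coeff x := by
  have h := a.2 ⟨x * t⁻¹ * x⁻¹, ‹T.Normal›.conj_mem _ (inv_mem ht) x⟩
  conv_rhs => rw [← h]
  simp [Representation.coeff_ofMulAction, mul_assoc]

variable (k T) in
/-- The `T`-invariants of the left regular representation of `G`, for `T` finite, are the left
regular representation of `G ⧸ T`. -/
def leftRegularIso [T.Normal] [Finite T] :
    (leftRegular k G).quotientToInvariants T ≅ leftRegular k (G ⧸ T) :=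
  Rep.mkIso <| .mk
    { toFun a := .ofCoeff (a.1.coeff.comapDomain Quotient.out Quotient.out_injective.injOn)
      map_add' _ _ := by ext; simp
      map_smul' _ _ := by ext; simp
      invFun b := ⟨.ofCoeff <| .ofSupportFinite (fun x : G => b.coeff (x : G ⧸ T)) <|
          b.coeff.hasFiniteSupport.preimage' fun q _ => by
            induction q using QuotientGroup.induction_on with | H y =>
            refine (Set.finite_range fun t : T => y * t).subset fun x hx => ?_
            exact ⟨⟨y⁻¹ * x, QuotientGroup.eq.1 (Eq.symm hx)⟩, mul_inv_cancel_left y x⟩,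
        fun t => by
        refine MonoidAlgebra.ext (Finsupp.ext fun x => ?_)
        refine (Representation.coeff_ofMulAction _ _ _).trans (congrArg b.coeff ?_)
        refine Eq.symm (QuotientGroup.eq.2 ?_)
        change x⁻¹ * ((t : G)⁻¹ * x) ∈ T
        simpa [mul_assoc] using ‹T.Normal›.conj_mem _ (inv_mem t.2) x⁻¹⟩
      left_inv a := by
        refine Subtype.ext (MonoidAlgebra.ext (Finsupp.ext fun x => ?_))
        obtain ⟨t, ht⟩ := QuotientGroup.mk_out_eq_mul T x
        exact (congrArg a.1.coeff ht).trans (coeff_mul_of_mem_invariants a x t.2)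
      right_inv b := by
        refine MonoidAlgebra.ext (Finsupp.ext fun q => ?_)
        exact congrArg b.coeff (QuotientGroup.out_eq' q) } fun g =>
    QuotientGroup.induction_on g fun g => by
      refine LinearMap.ext fun a => MonoidAlgebra.ext (Finsupp.ext fun q => ?_)
      induction q using QuotientGroup.induction_on with | H y =>
      obtain ⟨t, ht⟩ := QuotientGroup.mk_out_eq_mul T y
      obtain ⟨u, hu⟩ := QuotientGroup.mk_out_eq_mul T (g⁻¹ * y)
      refine Eq.symm ((Representation.coeff_ofMulAction _ _ _).trans ?_)
      change a.1.coeff ((g⁻¹ * y : G) : G ⧸ T).out = _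
      refine Eq.trans ?_ (Representation.coeff_ofMulAction g a.1 _).symm
      rw [hu, ht, smul_eq_mul, ← mul_assoc, coeff_mul_of_mem_invariants _ _ u.2,
        coeff_mul_of_mem_invariants _ _ t.2]

end leftRegular

end

end Rep

/-- If `T` is a finite normal subgroup of `G`, then for every `j` there is an isomorphism
of abelian groups `H^j(G; ℤ[G]) ≅ H^j(G/T; ℤ[G/T])`, where the coefficients are the
left regular representations. -/
theorem groupCohomology_leftRegular_iso_of_finite_normal
    {G : Type} [Group G] (T : Subgroup G) [T.Normal] [Finite T] (j : ℕ) :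
    Nonempty (groupCohomology (Rep.leftRegular ℤ G) j ≃+
      groupCohomology (Rep.leftRegular ℤ (G ⧸ T)) j) := by
  have := Fintype.ofFinite T
  obtain ⟨i⟩ := (Rep.isTraceOne_leftRegular (k := ℤ) (T := T)).nonempty_iso j
  exact ⟨(i.symm ≪≫ (groupCohomology.functor ℤ (G ⧸ T) j).mapIso
    (Rep.leftRegularIso ℤ T)).toLinearEquiv.toAddEquiv⟩
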